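/- Let Q_o = {(x,y) ∈ ℝ^n × ℝ^m : |x_i| ≤ 1 for i = 1,…,n and |y_j| ≤ 1 for j = 1,…,m}, let a(x,y) = sgn(x_1)·χ_{Q_o}(x,y), and let U = {x ∈ ℝ^n : 2 ≤ x_i ≤ 4 for i = 1,…,n}. Then there exists a constant c > 0, depending only on n, m, α, β, ρ, such that for every (x,y) ∈ U × ℝ^m one has I a(x,y) ≥ c·(1 + |y|)^{β−m}. -/

import Mathlib

open MeasureTheory

/-- The flag kernel `Ω(x,y) = |x|^(α-n) (|x|^ρ + |y|)^(β-m)` on `ℝ^n × ℝ^m`. -/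
noncomputable def flagKernel (n m : ℕ) (α β ρ : ℝ)
    (x : EuclideanSpace ℝ (Fin n)) (y : EuclideanSpace ℝ (Fin m)) : ℝ :=
  ‖x‖ ^ (α - (n : ℝ)) * (‖x‖ ^ ρ + ‖y‖) ^ (β - (m : ℝ))

/-- The fractional integral operator `I f(x,y) = ∬ f(u,v) Ω(x-u, y-v) du dv`. -/
noncomputable def flagOp (n m : ℕ) (α β ρ : ℝ)
    (f : EuclideanSpace ℝ (Fin n) × EuclideanSpace ℝ (Fin m) → ℝ)
    (z : EuclideanSpace ℝ (Fin n) × EuclideanSpace ℝ (Fin m)) : ℝ :=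
  ∫ w : EuclideanSpace ℝ (Fin n) × EuclideanSpace ℝ (Fin m),
    f w * flagKernel n m α β ρ (z.1 - w.1) (z.2 - w.2)

/-- The reflection of `ℝ^n` which changes the sign of the `k`-th coordinate. -/
noncomputable def coordReflection {n : ℕ} (k : Fin n) :
    EuclideanSpace ℝ (Fin n) ≃ₗᵢ[ℝ] EuclideanSpace ℝ (Fin n) :=
  LinearIsometryEquiv.piLpCongrRight 2
    (fun i => if i = k then LinearIsometryEquiv.neg ℝ else LinearIsometryEquiv.refl ℝ ℝ)

lemma coordReflection_apply {n : ℕ} (k : Fin n) (u : EuclideanSpace ℝ (Fin n)) (i : Fin n) :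
    coordReflection k u i = if i = k then -u i else u i := by
  unfold coordReflection
  rw [LinearIsometryEquiv.piLpCongrRight_apply]
  by_cases h : i = k <;> simp [h]

lemma coordReflection_coordReflection {n : ℕ} (k : Fin n) (u : EuclideanSpace ℝ (Fin n)) :
    coordReflection k (coordReflection k u) = u := by
  ext i
  by_cases h : i = k <;> simp [coordReflection_apply, h]

lemma abs_coordReflection_apply {n : ℕ} (k : Fin n) (u : EuclideanSpace ℝ (Fin n)) (i : Fin n) :
    |coordReflection k u i| = |u i| := by
  rw [coordReflection_apply]
  split_ifs <;> simp

lemma norm_sub_coordReflection_sq {n : ℕ} (k : Fin n) (x u : EuclideanSpace ℝ (Fin n)) :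
    ‖x - coordReflection k u‖ ^ 2 = ‖x - u‖ ^ 2 + 4 * x k * u k := by
  rw [EuclideanSpace.norm_sq_eq, EuclideanSpace.norm_sq_eq]
  have h : ∀ i, ‖(x - coordReflection k u) i‖ ^ 2
      = ‖(x - u) i‖ ^ 2 + if i = k then 4 * x i * u i else 0 := by
    intro i
    simp only [PiLp.sub_apply, coordReflection_apply, Real.norm_eq_abs, sq_abs]
    split_ifs <;> ring
  rw [Finset.sum_congr rfl fun i _ => h i, Finset.sum_add_distrib]
  simp

lemma EuclideanSpace.norm_le_sqrt_mul_of_abs_le {n : ℕ} {C : ℝ} (hC : 0 ≤ C)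
    {x : EuclideanSpace ℝ (Fin n)} (hx : ∀ i, |x i| ≤ C) : ‖x‖ ≤ √n * C := by
  rw [EuclideanSpace.norm_eq]
  calc √(∑ i, ‖x i‖ ^ 2) ≤ √(∑ _i : Fin n, C ^ 2) := by
        gcongr with i
        exact hx i
    _ = √n * C := by simp [Real.sqrt_sq hC]

lemma flagKernel_nonneg (n m : ℕ) (α β ρ : ℝ) (ξ : EuclideanSpace ℝ (Fin n))
    (η : EuclideanSpace ℝ (Fin m)) : 0 ≤ flagKernel n m α β ρ ξ η := by
  unfold flagKernel
  positivity

lemma flagKernel_le_one {n m : ℕ} {α β ρ : ℝ} (hαn : α < n) (hβm : β < m) (hρ : 1 ≤ ρ)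
    {ξ : EuclideanSpace ℝ (Fin n)} (hξ : 1 ≤ ‖ξ‖) (η : EuclideanSpace ℝ (Fin m)) :
    flagKernel n m α β ρ ξ η ≤ 1 := by
  have h : 1 ≤ ‖ξ‖ ^ ρ := Real.one_le_rpow hξ (by linarith)
  exact mul_le_one₀ (Real.rpow_le_one_of_one_le_of_nonpos hξ (by linarith)) (by positivity)
    (Real.rpow_le_one_of_one_le_of_nonpos (by linarith [norm_nonneg η]) (by linarith))

lemma flagKernel_anti {n m : ℕ} {α β ρ : ℝ} (hαn : α < n) (hβm : β < m) (hρ : 1 ≤ ρ)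
    {ξ ξ' : EuclideanSpace ℝ (Fin n)} (hξ : 0 < ‖ξ‖) (h : ‖ξ‖ ≤ ‖ξ'‖)
    (η : EuclideanSpace ℝ (Fin m)) :
    flagKernel n m α β ρ ξ' η ≤ flagKernel n m α β ρ ξ η := by
  have h₁ : 0 < ‖ξ‖ ^ ρ := Real.rpow_pos_of_pos hξ _
  have h₂ : ‖ξ‖ ^ ρ ≤ ‖ξ'‖ ^ ρ := Real.rpow_le_rpow hξ.le h (by linarith)
  exact mul_le_mul (Real.rpow_le_rpow_of_nonpos hξ h (by linarith))
    (Real.rpow_le_rpow_of_nonpos (by positivity) (by linarith) (by linarith))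
    (by positivity) (by positivity)

lemma flagKernel_sub_lower_bound {n m : ℕ} {α β ρ : ℝ} (hαn : α < n) (hβm : β < m) (hρ : 1 ≤ ρ)
    {C : ℝ} {ξ ξ' : EuclideanSpace ℝ (Fin n)} (hξ : 0 < ‖ξ‖)
    (h : ‖ξ‖ ^ 2 + 4 ≤ ‖ξ'‖ ^ 2) (hC : ‖ξ'‖ ≤ C) (η : EuclideanSpace ℝ (Fin m)) :
    (1 - √(1 + 4 / C ^ 2) ^ (α - n)) * C ^ (α - n) * (C ^ ρ + ‖η‖) ^ (β - m) ≤
      flagKernel n m α β ρ ξ η - flagKernel n m α β ρ ξ' η := by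
  have hle : ‖ξ‖ ≤ ‖ξ'‖ := by nlinarith [norm_nonneg ξ']
  have hC0 : 0 < C := by linarith
  set l := √(1 + 4 / C ^ 2) with hl
  have hl1 : 1 ≤ l := Real.one_le_sqrt.2 (by linarith [show 0 ≤ 4 / C ^ 2 by positivity])
  have hlξ : l * ‖ξ‖ ≤ ‖ξ'‖ := by
    refine (sq_le_sq₀ (by positivity) (by positivity)).1 ?_
    rw [mul_pow, hl, Real.sq_sqrt (by positivity)]
    have : 4 / C ^ 2 * ‖ξ‖ ^ 2 ≤ 4 := by
      rw [div_mul_eq_mul_div, div_le_iff₀ (by positivity)]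
      have : ‖ξ‖ ^ 2 ≤ C ^ 2 := by gcongr; linarith
      linarith
    linarith
  have hl1' : l ^ (α - n) ≤ 1 := Real.rpow_le_one_of_one_le_of_nonpos hl1 (by linarith)
  have hrad : (1 - l ^ (α - n)) * C ^ (α - n) ≤ ‖ξ‖ ^ (α - n) - ‖ξ'‖ ^ (α - n) := by
    have h₁ : ‖ξ'‖ ^ (α - n) ≤ l ^ (α - n) * ‖ξ‖ ^ (α - n) := by
      rw [← Real.mul_rpow (by linarith) hξ.le]
      exact Real.rpow_le_rpow_of_nonpos (by positivity) hlξ (by linarith)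
    have h₂ : C ^ (α - n) ≤ ‖ξ‖ ^ (α - n) :=
      Real.rpow_le_rpow_of_nonpos hξ (by linarith) (by linarith)
    nlinarith
  have hξρ : 0 < ‖ξ‖ ^ ρ := Real.rpow_pos_of_pos hξ _
  have h₂ : ‖ξ‖ ^ ρ ≤ ‖ξ'‖ ^ ρ := Real.rpow_le_rpow hξ.le hle (by linarith)
  have h₃ : ‖ξ'‖ ^ ρ ≤ C ^ ρ := Real.rpow_le_rpow (norm_nonneg _) hC (by linarith)
  have h₄ : (‖ξ'‖ ^ ρ + ‖η‖) ^ (β - m) ≤ (‖ξ‖ ^ ρ + ‖η‖) ^ (β - m) :=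
    Real.rpow_le_rpow_of_nonpos (by positivity) (by linarith) (by linarith)
  have h₅ : (C ^ ρ + ‖η‖) ^ (β - m) ≤ (‖ξ'‖ ^ ρ + ‖η‖) ^ (β - m) :=
    Real.rpow_le_rpow_of_nonpos (by linarith [norm_nonneg η]) (by linarith) (by linarith)
  have hnn : 0 ≤ (1 - l ^ (α - n)) * C ^ (α - n) := mul_nonneg (by linarith) (by positivity)
  calc _ ≤ (‖ξ‖ ^ (α - n) - ‖ξ'‖ ^ (α - n)) * (‖ξ'‖ ^ ρ + ‖η‖) ^ (β - m) :=
        mul_le_mul hrad h₅ (by positivity) (hnn.trans hrad)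
    _ ≤ ‖ξ‖ ^ (α - n) * (‖ξ‖ ^ ρ + ‖η‖) ^ (β - m)
          - ‖ξ'‖ ^ (α - n) * (‖ξ'‖ ^ ρ + ‖η‖) ^ (β - m) := by
        rw [sub_mul]
        gcongr

lemma isCompact_prod_cube (n m : ℕ) :
    IsCompact {w : EuclideanSpace ℝ (Fin n) × EuclideanSpace ℝ (Fin m) |
      (∀ i, |w.1 i| ≤ 1) ∧ (∀ j, |w.2 j| ≤ 1)} := by
  refine ((isCompact_closedBall 0 (√n * 1)).prod
    (isCompact_closedBall 0 (√m * 1))).of_isClosed_subset ?_ ?_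
  · simp only [Set.ofPred_and, Set.ofPred_forall]
    refine (isClosed_iInter fun i => ?_).inter (isClosed_iInter fun j => ?_) <;>
    exact isClosed_le (by fun_prop) (by fun_prop)
  · rintro ⟨u, v⟩ ⟨hu, hv⟩
    simp only [Set.mem_prod, mem_closedBall_zero_iff]
    exact ⟨EuclideanSpace.norm_le_sqrt_mul_of_abs_le zero_le_one hu,
      EuclideanSpace.norm_le_sqrt_mul_of_abs_le zero_le_one hv⟩

/-- The part of the open unit cube of `ℝ^n × ℝ^m` on which `u_k > 1/2`. -/
def halfCube {n : ℕ} (m : ℕ) (k : Fin n) :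
    Set (EuclideanSpace ℝ (Fin n) × EuclideanSpace ℝ (Fin m)) :=
  {w | 1 / 2 < w.1 k ∧ (∀ i, |w.1 i| < 1) ∧ (∀ j, |w.2 j| < 1)}

lemma isOpen_halfCube {n : ℕ} (m : ℕ) (k : Fin n) : IsOpen (halfCube m k) := by
  simp only [halfCube, Set.ofPred_and, Set.ofPred_forall]
  refine (isOpen_lt (by fun_prop) (by fun_prop)).inter
    ((isOpen_iInter_of_finite fun i => ?_).inter (isOpen_iInter_of_finite fun j => ?_)) <;>
  exact isOpen_lt (by fun_prop) (by fun_prop)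

lemma halfCube_nonempty {n : ℕ} (m : ℕ) (k : Fin n) : (halfCube m k).Nonempty := by
  refine ⟨(WithLp.toLp 2 fun _ => 3 / 4, 0), ?_, ?_, ?_⟩
  · norm_num
  · intro i
    norm_num [abs_lt]
  · simp

lemma volume_halfCube_lt_top {n : ℕ} (m : ℕ) (k : Fin n) : volume (halfCube m k) < ⊤ :=
  lt_of_le_of_lt
    (measure_mono fun _ hw => And.intro (fun i => (hw.2.1 i).le) fun j => (hw.2.2 j).le)
    (isCompact_prod_cube n m).measure_lt_top

lemma measureReal_halfCube_pos {n : ℕ} (m : ℕ) (k : Fin n) :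
    0 < volume.real (halfCube m k) :=
  ENNReal.toReal_pos ((isOpen_halfCube m k).measure_pos _ (halfCube_nonempty m k)).ne'
    (volume_halfCube_lt_top m k).ne

lemma measurePreserving_coordReflection_prod {n : ℕ} (m : ℕ) (k : Fin n) :
    MeasurePreserving (fun w : EuclideanSpace ℝ (Fin n) × EuclideanSpace ℝ (Fin m) =>
      (coordReflection k w.1, w.2)) :=
  (coordReflection k).measurePreserving.prod (MeasurePreserving.id volume)

/-- The atom `sgn(u_k) χ_{Q_o}`. -/
noncomputable def signAtom {n : ℕ} (m : ℕ) (k : Fin n) :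
    EuclideanSpace ℝ (Fin n) × EuclideanSpace ℝ (Fin m) → ℝ :=
  Set.indicator {w | (∀ i, |w.1 i| ≤ 1) ∧ (∀ j, |w.2 j| ≤ 1)} fun w => Real.sign (w.1 k)

lemma signAtom_coordReflection {n m : ℕ} (k : Fin n)
    (w : EuclideanSpace ℝ (Fin n) × EuclideanSpace ℝ (Fin m)) :
    signAtom m k (coordReflection k w.1, w.2) = -signAtom m k w := by
  simp only [signAtom, Set.indicator_apply, Set.mem_ofPred_eq, abs_coordReflection_apply]
  split_ifs <;> simp [coordReflection_apply, Real.sign_neg]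

lemma one_le_norm_sub {n : ℕ} (k : Fin n) {x u : EuclideanSpace ℝ (Fin n)}
    (hx : 2 ≤ x k) (hu : |u k| ≤ 1) : 1 ≤ ‖x - u‖ := by
  have h := PiLp.norm_apply_le (x - u) k
  rw [Real.norm_eq_abs, PiLp.sub_apply] at h
  linarith [le_abs_self (x k - u k), le_abs_self (u k)]

lemma integrable_signAtom_mul_flagKernel {n m : ℕ} {α β ρ : ℝ} (hαn : α < n) (hβm : β < m)
    (hρ : 1 ≤ ρ) (k : Fin n) {z : EuclideanSpace ℝ (Fin n) × EuclideanSpace ℝ (Fin m)}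
    (hz : 2 ≤ z.1 k) :
    Integrable fun w => signAtom m k w * flagKernel n m α β ρ (z.1 - w.1) (z.2 - w.2) := by
  have hQ := isCompact_prod_cube n m
  have hQm := hQ.isClosed.measurableSet
  have hsign : Measurable Real.sign := by
    unfold Real.sign
    exact Measurable.ite measurableSet_Iio measurable_const
      (Measurable.ite measurableSet_Ioi measurable_const measurable_const)
  have hint : Integrable (Set.indicator {w : EuclideanSpace ℝ (Fin n) × EuclideanSpace ℝ (Fin m) |
      (∀ i, |w.1 i| ≤ 1) ∧ (∀ j, |w.2 j| ≤ 1)} fun _ => (1 : ℝ)) :=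
    (integrable_indicator_iff hQm).2 (integrableOn_const hQ.measure_lt_top.ne)
  have hatom : Measurable (signAtom m k) :=
    Measurable.indicator (hsign.comp (by fun_prop)) hQm
  have hker : Measurable fun w : EuclideanSpace ℝ (Fin n) × EuclideanSpace ℝ (Fin m) =>
      flagKernel n m α β ρ (z.1 - w.1) (z.2 - w.2) := by
    unfold flagKernel
    fun_prop
  refine hint.mono' (Measurable.aestronglyMeasurable ?_) (Filter.Eventually.of_forall fun w => ?_)
  · exact hatom.mul hker
  · by_cases hw : (∀ i, |w.1 i| ≤ 1) ∧ (∀ j, |w.2 j| ≤ 1)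
    · have hs : |Real.sign (w.1 k)| ≤ 1 := by
        rcases Real.sign_apply_eq (w.1 k) with h | h | h <;> simp [h]
      simp only [signAtom, Set.indicator_apply, Set.mem_ofPred_eq, if_pos hw, norm_mul,
        Real.norm_eq_abs, abs_of_nonneg (flagKernel_nonneg _ _ _ _ _ _ _)]
      exact mul_le_one₀ hs (flagKernel_nonneg _ _ _ _ _ _ _)
        (flagKernel_le_one hαn hβm hρ (one_le_norm_sub k hz (hw.1 k)) _)
    · simp [signAtom, hw]

lemma signAtom_mul_flagKernel_sub_nonneg {n m : ℕ} {α β ρ : ℝ} (hαn : α < n) (hβm : β < m)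
    (hρ : 1 ≤ ρ) (k : Fin n) {z : EuclideanSpace ℝ (Fin n) × EuclideanSpace ℝ (Fin m)}
    (hz : 2 ≤ z.1 k) (w : EuclideanSpace ℝ (Fin n) × EuclideanSpace ℝ (Fin m)) :
    0 ≤ signAtom m k w * (flagKernel n m α β ρ (z.1 - w.1) (z.2 - w.2)
      - flagKernel n m α β ρ (z.1 - coordReflection k w.1) (z.2 - w.2)) := by
  by_cases hw : (∀ i, |w.1 i| ≤ 1) ∧ (∀ j, |w.2 j| ≤ 1)
  · have h₁ : 1 ≤ ‖z.1 - w.1‖ := one_le_norm_sub k hz (hw.1 k)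
    have h₂ : 1 ≤ ‖z.1 - coordReflection k w.1‖ :=
      one_le_norm_sub k hz (by rw [abs_coordReflection_apply]; exact hw.1 k)
    have hsq := norm_sub_coordReflection_sq k z.1 w.1
    simp only [signAtom, Set.indicator_apply, Set.mem_ofPred_eq, if_pos hw]
    rcases lt_trichotomy (w.1 k) 0 with h | h | h
    · rw [Real.sign_of_neg h]
      have : ‖z.1 - coordReflection k w.1‖ ≤ ‖z.1 - w.1‖ := by
        refine (sq_le_sq₀ (by positivity) (by positivity)).1 ?_
        nlinarith
      linarith [flagKernel_anti hαn hβm hρ (by linarith) this (z.2 - w.2)]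
    · simp [h]
    · rw [Real.sign_of_pos h]
      have : ‖z.1 - w.1‖ ≤ ‖z.1 - coordReflection k w.1‖ := by
        refine (sq_le_sq₀ (by positivity) (by positivity)).1 ?_
        nlinarith
      linarith [flagKernel_anti hαn hβm hρ (by linarith) this (z.2 - w.2)]
  · simp [signAtom, hw]

lemma two_mul_flagOp_signAtom {n m : ℕ} {α β ρ : ℝ} (hαn : α < n) (hβm : β < m)
    (hρ : 1 ≤ ρ) (k : Fin n) {z : EuclideanSpace ℝ (Fin n) × EuclideanSpace ℝ (Fin m)}
    (hz : 2 ≤ z.1 k) :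
    Integrable (fun w => signAtom m k w * (flagKernel n m α β ρ (z.1 - w.1) (z.2 - w.2)
      - flagKernel n m α β ρ (z.1 - coordReflection k w.1) (z.2 - w.2))) ∧
    2 * flagOp n m α β ρ (signAtom m k) z =
      ∫ w, signAtom m k w * (flagKernel n m α β ρ (z.1 - w.1) (z.2 - w.2)
        - flagKernel n m α β ρ (z.1 - coordReflection k w.1) (z.2 - w.2)) := by
  have hF := integrable_signAtom_mul_flagKernel hαn hβm hρ k hz
  have hR := measurePreserving_coordReflection_prod m k
  have hRe : MeasurableEmbedding
      (fun w : EuclideanSpace ℝ (Fin n) × EuclideanSpace ℝ (Fin m) =>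
        (coordReflection k w.1, w.2)) :=
    ((coordReflection k).toHomeomorph.prodCongr (Homeomorph.refl _)).measurableEmbedding
  have hFR := (hR.integrable_comp_emb hRe).2 hF
  have hI := hR.integral_comp hRe
    (fun w => signAtom m k w * flagKernel n m α β ρ (z.1 - w.1) (z.2 - w.2))
  have hsum : (fun w => signAtom m k w * (flagKernel n m α β ρ (z.1 - w.1) (z.2 - w.2)
      - flagKernel n m α β ρ (z.1 - coordReflection k w.1) (z.2 - w.2))) =
      fun w => signAtom m k w * flagKernel n m α β ρ (z.1 - w.1) (z.2 - w.2) +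
        signAtom m k (coordReflection k w.1, w.2) *
          flagKernel n m α β ρ (z.1 - coordReflection k w.1) (z.2 - w.2) := by
    funext w
    rw [signAtom_coordReflection]
    ring
  rw [hsum]
  refine ⟨hF.add hFR, ?_⟩
  refine Eq.trans ?_ (integral_add hF hFR).symm
  rw [two_mul]
  exact congrArg₂ (· + ·) rfl hI.symm

lemma add_norm_sub_rpow_lower_bound {m : ℕ} {A s : ℝ} (hA : 1 ≤ A) (hs : s ≤ 0)
    {y v : EuclideanSpace ℝ (Fin m)} (hv : ∀ j, |v j| ≤ 1) :
    (A + √m) ^ s * (1 + ‖y‖) ^ s ≤ (A + ‖y - v‖) ^ s := by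
  have hv' : ‖v‖ ≤ √m := by
    simpa using EuclideanSpace.norm_le_sqrt_mul_of_abs_le zero_le_one hv
  have hm : 0 ≤ √(m : ℝ) := Real.sqrt_nonneg _
  rw [← Real.mul_rpow (by positivity) (by positivity)]
  refine Real.rpow_le_rpow_of_nonpos (by positivity) ?_ hs
  nlinarith [norm_sub_le y v, norm_nonneg y, mul_nonneg hm (norm_nonneg y)]

lemma halfCube_signAtom_mul_flagKernel_sub_lower_bound {n m : ℕ} {α β ρ : ℝ} (hαn : α < n)
    (hβm : β < m) (hρ : 1 ≤ ρ) (k : Fin n)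
    {z w : EuclideanSpace ℝ (Fin n) × EuclideanSpace ℝ (Fin m)}
    (hz : ∀ i, 2 ≤ z.1 i ∧ z.1 i ≤ 4) (hw : w ∈ halfCube m k) {C : ℝ} (hC : C = √n * 5) :
    (1 - √(1 + 4 / C ^ 2) ^ (α - n)) * C ^ (α - n) *
        ((C ^ ρ + √m) ^ (β - m) * (1 + ‖z.2‖) ^ (β - m)) ≤
      signAtom m k w * (flagKernel n m α β ρ (z.1 - w.1) (z.2 - w.2)
        - flagKernel n m α β ρ (z.1 - coordReflection k w.1) (z.2 - w.2)) := by
  obtain ⟨hwk, hw₁, hw₂⟩ := hw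
  have hQ : (∀ i, |w.1 i| ≤ 1) ∧ (∀ j, |w.2 j| ≤ 1) :=
    ⟨fun i => (hw₁ i).le, fun j => (hw₂ j).le⟩
  have h₁ : 1 ≤ ‖z.1 - w.1‖ := one_le_norm_sub k (hz k).1 (hQ.1 k)
  have h₂ : 1 ≤ ‖z.1 - coordReflection k w.1‖ :=
    one_le_norm_sub k (hz k).1 (by rw [abs_coordReflection_apply]; exact hQ.1 k)
  have hsq := norm_sub_coordReflection_sq k z.1 w.1
  have hle : ‖z.1 - coordReflection k w.1‖ ≤ C := by
    rw [hC]
    refine EuclideanSpace.norm_le_sqrt_mul_of_abs_le (by norm_num) fun i => ?_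
    have := abs_le.1 ((abs_coordReflection_apply k w.1 i).trans_le (hQ.1 i))
    rw [PiLp.sub_apply, abs_le]
    constructor <;> linarith [(hz i).1, (hz i).2]
  have hC1 : 1 ≤ C := h₂.trans hle
  have hl : √(1 + 4 / C ^ 2) ^ (α - n) ≤ 1 :=
    Real.rpow_le_one_of_one_le_of_nonpos
      (Real.one_le_sqrt.2 (by linarith [show 0 ≤ 4 / C ^ 2 by positivity])) (by linarith)
  have hatom : signAtom m k w = 1 := by
    simp only [signAtom, Set.indicator_apply, Set.mem_ofPred_eq, if_pos hQ]
    exact Real.sign_of_pos (by linarith)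
  rw [hatom, one_mul]
  refine le_trans ?_ (flagKernel_sub_lower_bound hαn hβm hρ (by linarith)
    (by nlinarith [(hz k).1]) hle (z.2 - w.2))
  exact mul_le_mul_of_nonneg_left (add_norm_sub_rpow_lower_bound
    (Real.one_le_rpow hC1 (by linarith)) (by linarith) hQ.2)
    (mul_nonneg (by linarith) (by positivity))

/-- Pointwise lower bound: for the atom `a = sgn(x₁) χ_{Q_o}`, on `U × ℝ^m` one has
`I a(x,y) ≥ c (1+|y|)^{β-m}` for some `c > 0` depending only on `n, m, α, β, ρ`. -/
theorem flagOp_atom_pointwise_lower_bound (n m : ℕ) (hn : 0 < n) (hm : 0 < m) (α β ρ : ℝ)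
    (hα : 0 < α) (hαn : α < n) (hβ : 0 < β) (hβm : β < m) (hρ : 1 ≤ ρ) :
    ∃ c : ℝ, 0 < c ∧
      ∀ w : EuclideanSpace ℝ (Fin n) × EuclideanSpace ℝ (Fin m),
        (∀ i, 2 ≤ w.1 i ∧ w.1 i ≤ 4) →
        c * (1 + ‖w.2‖) ^ (β - (m : ℝ)) ≤
          flagOp n m α β ρ
            (Set.indicator
              {w : EuclideanSpace ℝ (Fin n) × EuclideanSpace ℝ (Fin m) |
                (∀ i, |w.1 i| ≤ 1) ∧ (∀ j, |w.2 j| ≤ 1)}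
              (fun w => Real.sign (w.1 ⟨0, hn⟩))) w := by
  set k : Fin n := ⟨0, hn⟩
  obtain ⟨C, hC⟩ : ∃ C : ℝ, C = √n * 5 := ⟨_, rfl⟩
  have hC0 : 0 < C := by
    rw [hC]
    positivity
  have hl : √(1 + 4 / C ^ 2) ^ (α - n) < 1 :=
    Real.rpow_lt_one_of_one_lt_of_neg
      (Real.lt_sqrt_of_sq_lt (by linarith [show 0 < 4 / C ^ 2 by positivity])) (by linarith)
  have hV := measureReal_halfCube_pos m k
  set D : ℝ := (1 - √(1 + 4 / C ^ 2) ^ (α - n)) * C ^ (α - n) * (C ^ ρ + √m) ^ (β - m) with hD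
  have hD0 : 0 < D := mul_pos (mul_pos (by linarith) (by positivity)) (by positivity)
  refine ⟨volume.real (halfCube m k) * D / 2, by positivity, fun z hz => ?_⟩
  change _ ≤ flagOp n m α β ρ (signAtom m k) z
  obtain ⟨hint, h2⟩ := two_mul_flagOp_signAtom (β := β) hαn hβm hρ k (hz k).1
  have hmeas := (isOpen_halfCube m k).measurableSet
  have hlow : volume.real (halfCube m k) * (D * (1 + ‖z.2‖) ^ (β - m)) ≤
      2 * flagOp n m α β ρ (signAtom m k) z := by
    rw [h2, ← smul_eq_mul, ← integral_indicator_const _ hmeas]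
    refine integral_mono ((integrable_indicator_iff hmeas).2
      (integrableOn_const (volume_halfCube_lt_top m k).ne)) hint fun w => ?_
    by_cases hw : w ∈ halfCube m k
    · simp only [Set.indicator_of_mem hw, hD]
      rw [mul_assoc _ ((C ^ ρ + √m) ^ (β - m))]
      exact halfCube_signAtom_mul_flagKernel_sub_lower_bound hαn hβm hρ k hz hw hC
    · simp only [Set.indicator_of_notMem hw]
      exact signAtom_mul_flagKernel_sub_nonneg hαn hβm hρ k (hz k).1 w
  linarith
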